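/- Let h ≥ 1 be an integer, let v₀, w ∈ 𝔽_h with v₀ ≥ 0 on Ω, and let (u_j, v_j)_{j≥1} be the alternating minimization sequences. Then: (1) there exist ū, v̄ ∈ 𝔽_h such that u_j → ū and v_j → v̄ in 𝔽_h as j → ∞; (2) 0 ≤ v̄ ≤ 1 on Ω; (3) J_h(ū, v̄) ≤ J_h(u, v̄) for every u ∈ 𝔄_h(w), and J_h(ū, v̄) ≤ J_h(ū, v) for every v ∈ 𝔽_h with v ≤ v̄ on Ω. -/

import Mathlib

open MeasureTheory Filter
open scoped Classical
open scoped RealInnerProductSpace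

noncomputable section

abbrev E2 : Type := EuclideanSpace ℝ (Fin 2)

/-- The point `(a, b) ∈ ℝ²`. -/
def vtx (a b : ℝ) : E2 := (WithLp.equiv 2 (Fin 2 → ℝ)).symm ![a, b]

/-- The open unit square `Ω = (0,1)²`. -/
def Omega : Set E2 := {x | x 0 ∈ Set.Ioo (0:ℝ) 1 ∧ x 1 ∈ Set.Ioo (0:ℝ) 1}

/-- The closed unit square `Ω̄ = [0,1]²`. -/
def OmegaCl : Set E2 := {x | x 0 ∈ Set.Icc (0:ℝ) 1 ∧ x 1 ∈ Set.Icc (0:ℝ) 1}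

/-- The boundary `∂Ω = Ω̄ \ Ω`. -/
def OmegaBd : Set E2 := OmegaCl \ Omega

/-- Lower-left triangle `K⁺_{k,j}` of the uniform triangulation `𝒯_h`. -/
def Kplus (h k j : ℕ) : Set E2 :=
  {x | ((k:ℝ)-1)/h ≤ x 0 ∧ x 0 ≤ (k:ℝ)/h ∧ ((j:ℝ)-1)/h ≤ x 1 ∧
        x 1 ≤ ((j:ℝ)-1)/h + ((k:ℝ)/h - x 0)}

/-- Upper-right triangle `K⁻_{k,j}` of the uniform triangulation `𝒯_h`. -/
def Kminus (h k j : ℕ) : Set E2 :=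
  {x | ((k:ℝ)-1)/h ≤ x 0 ∧ x 0 ≤ (k:ℝ)/h ∧ (j:ℝ)/h + (((k:ℝ)-1)/h - x 0) ≤ x 1 ∧
        x 1 ≤ (j:ℝ)/h}

/-- `u` is affine on the set `S`. -/
def IsAffineOn (u : E2 → ℝ) (S : Set E2) : Prop :=
  ∃ (b : E2) (c : ℝ), ∀ x ∈ S, u x = ⟪b, x⟫ + c

/-- Membership in the finite element space `𝔽_h`: continuous on `Ω̄` and affine on every
triangle of the uniform triangulation `𝒯_h`. -/
def MemF (h : ℕ) (u : E2 → ℝ) : Prop :=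
  ContinuousOn u OmegaCl ∧
  ∀ k j : ℕ, 1 ≤ k → k ≤ h → 1 ≤ j → j ≤ h →
    IsAffineOn u (Kplus h k j) ∧ IsAffineOn u (Kminus h k j)

/-- The set `Δ_h` of vertices of the triangulation `𝒯_h`. -/
def Delta (h : ℕ) : Set E2 :=
  {x | ∃ k j : ℕ, k ≤ h ∧ j ≤ h ∧ x = vtx ((k:ℝ)/h) ((j:ℝ)/h)}

/-- The vertex `(k/h, j/h)` of `𝒯_h`. -/
def vertexPt (h k j : ℕ) : E2 := vtx ((k:ℝ)/h) ((j:ℝ)/h)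

/-- `p` is the Lagrange interpolant of `f` on `𝒯_h`: `p ∈ 𝔽_h` and `p = f` on `Δ_h`. -/
def Interpolates (h : ℕ) (f p : E2 → ℝ) : Prop :=
  MemF h p ∧ ∀ x ∈ Delta h, p x = f x

/-- The Lagrange interpolation operator `P_h` (a choice of interpolant; it is unique on `Ω̄`). -/

noncomputable def Ph (h : ℕ) (f : E2 → ℝ) : E2 → ℝ :=
  if hf : ∃ p, Interpolates h f p then hf.choose else 0

/-- Almost-everywhere defined gradient. -/
noncomputable def grad (u : E2 → ℝ) (x : E2) : E2 := gradient u x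

/-- The squared `H¹(Ω)` norm `‖u‖²_{H¹} = ∫_Ω (u² + |∇u|²)`. -/
noncomputable def H1normSq (u : E2 → ℝ) : ℝ :=
  ∫ x in Omega, ((u x)^2 + ‖grad u x‖^2)

/-- The discrete phase-field energy `J_h`. -/
noncomputable def Jh (h : ℕ) (η : ℝ) (u v : E2 → ℝ) : ℝ :=
  (1/2) * (∫ x in Omega, ((Ph h (fun y => (v y)^2) x + η) * ‖grad u x‖^2))
  + (1/2) * (∫ x in Omega, ‖grad v x‖^2)
  + (1/2) * (∫ x in Omega, Ph h (fun y => (1 - v y)^2) x)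

/-- `u ∈ 𝔄_h(w)`: `u ∈ 𝔽_h` and `u = w` on `∂Ω`. -/
def MemA (h : ℕ) (w u : E2 → ℝ) : Prop :=
  MemF h u ∧ ∀ x ∈ OmegaBd, u x = w x

/-- Convergence in `𝔽_h`, i.e. with respect to the `H¹(Ω)` norm. -/
def TendstoF (u : ℕ → E2 → ℝ) (ub : E2 → ℝ) : Prop :=
  Tendsto (fun j => H1normSq (fun y => u j y - ub y)) atTop (nhds 0)

/-- `u` minimizes `J_h(·, v)` over `𝔄_h(w)`. -/
def IsMinU (h : ℕ) (η : ℝ) (w v u : E2 → ℝ) : Prop :=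
  MemA h w u ∧ ∀ u', MemA h w u' → Jh h η u v ≤ Jh h η u' v

/-- `v` minimizes `J_h(u, ·)` over `{v ∈ 𝔽_h : v ≤ vprev on Ω}`. -/
def IsMinV (h : ℕ) (η : ℝ) (u vprev v : E2 → ℝ) : Prop :=
  (MemF h v ∧ ∀ x ∈ Omega, v x ≤ vprev x) ∧
  ∀ v', MemF h v' → (∀ x ∈ Omega, v' x ≤ vprev x) → Jh h η u v ≤ Jh h η u v'

end

/-- The reference hat function of the triangulation of the plane by unit right triangles. -/
noncomputable def refHat (s t : ℝ) : ℝ := max 0 (1 - max |s| (max |t| |s + t|))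

lemma refHat_neg (s t : ℝ) : refHat (-s) (-t) = refHat s t := by
  unfold refHat
  rw [← neg_add, abs_neg, abs_neg, abs_neg]

lemma refHat_nonneg (s t : ℝ) : 0 ≤ refHat s t := le_max_left _ _

lemma refHat_le_one (s t : ℝ) : refHat s t ≤ 1 :=
  max_le zero_le_one (by linarith [le_max_of_le_left (c := max |t| |s + t|) (abs_nonneg s)])

lemma refHat_eq_zero_of_le {s t : ℝ} (hst : 1 ≤ max |s| (max |t| |s + t|)) : refHat s t = 0 :=
  max_eq_left (by linarith)

lemma one_le_abs_sub_intCast {p : ℝ} (h0 : 0 ≤ p) (h1 : p ≤ 1) {i : ℤ} (h_i0 : i ≠ 0)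
    (h_i1 : i ≠ 1) : 1 ≤ |p - i| := by
  rcases lt_or_ge i 0 with hi | hi
  · have : (i : ℝ) ≤ -1 := by exact_mod_cast Int.le_sub_one_of_lt hi
    rw [le_abs]; left; linarith
  · have : (2 : ℝ) ≤ i := by exact_mod_cast (by omega : (2 : ℤ) ≤ i)
    rw [le_abs]; right; linarith

lemma refHat_sub_intCast {p q : ℝ} (hp : 0 ≤ p) (hq : 0 ≤ q) (hpq : p + q ≤ 1) (i l : ℤ) :
    refHat (p - i) (q - l) = (if i = 0 ∧ l = 0 then 1 - p - q else 0)
      + (if i = 1 ∧ l = 0 then p else 0) + (if i = 0 ∧ l = 1 then q else 0) := by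
  by_cases hi : i = 0 ∨ i = 1
  swap
  · rw [not_or] at hi
    rw [refHat_eq_zero_of_le (le_max_of_le_left
      (one_le_abs_sub_intCast hp (by linarith) hi.1 hi.2))]
    simp [hi.1, hi.2]
  by_cases hl : l = 0 ∨ l = 1
  swap
  · rw [not_or] at hl
    rw [refHat_eq_zero_of_le (le_max_of_le_right (le_max_of_le_left
      (one_le_abs_sub_intCast hq (by linarith) hl.1 hl.2)))]
    simp [hl.1, hl.2]
  have hab : |p - 1| = 1 - p := by rw [abs_of_nonpos] <;> linarith
  have hab' : |q - 1| = 1 - q := by rw [abs_of_nonpos] <;> linarith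
  unfold refHat
  rcases hi with rfl | rfl <;> rcases hl with rfl | rfl
  · simp only [Int.cast_zero, sub_zero, abs_of_nonneg hp, abs_of_nonneg hq,
      abs_of_nonneg (add_nonneg hp hq)]
    rw [max_eq_right (by linarith : q ≤ p + q), max_eq_right (by linarith : p ≤ p + q),
      max_eq_right (by linarith)]
    simp; ring
  · simp only [Int.cast_zero, Int.cast_one, sub_zero, abs_of_nonneg hp, hab']
    rw [abs_of_nonpos (by linarith : p + (q - 1) ≤ 0),
      max_eq_left (by linarith : -(p + (q - 1)) ≤ 1 - q), max_eq_right (by linarith : p ≤ 1 - q),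
      max_eq_right (by linarith)]
    simp
  · simp only [Int.cast_zero, Int.cast_one, sub_zero, abs_of_nonneg hq, hab]
    rw [abs_of_nonpos (by linarith : (p - 1) + q ≤ 0),
      max_eq_left (max_le (by linarith) (by linarith)), max_eq_right (by linarith)]
    simp
  · simp only [Int.cast_one]
    rw [abs_of_nonpos (by linarith : (p - 1) + (q - 1) ≤ 0), max_eq_left]
    · simp
    · have := le_max_right |p - 1| (max |q - 1| (-((p - 1) + (q - 1))))
      have := le_max_right |q - 1| (-((p - 1) + (q - 1)))
      linarith

@[simp] lemma vtx_zero (a b : ℝ) : vtx a b 0 = a := rfl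

@[simp] lemma vtx_one (a b : ℝ) : vtx a b 1 = b := rfl

lemma norm_vtx_sq (a b : ℝ) : ‖vtx a b‖ ^ 2 = a ^ 2 + b ^ 2 := by
  simp [EuclideanSpace.norm_sq_eq, Fin.sum_univ_two]

lemma inner_eq_coord (b x : E2) : ⟪b, x⟫ = b 0 * x 0 + b 1 * x 1 := by
  simp [PiLp.inner_apply, Fin.sum_univ_two]; ring

lemma continuous_coord (i : Fin 2) : Continuous fun x : E2 => x i :=
  (EuclideanSpace.proj (𝕜 := ℝ) i).continuous

/-- Index set of the vertices of `𝒯_h`. -/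
abbrev Node (h : ℕ) : Type := Fin (h + 1) × Fin (h + 1)

/-- The vertex of `𝒯_h` with index `a`. -/
noncomputable def node (h : ℕ) (a : Node h) : E2 := vertexPt h a.1 a.2

@[simp] lemma node_zero (h : ℕ) (a : Node h) : node h a 0 = (a.1 : ℝ) / h := rfl

@[simp] lemma node_one (h : ℕ) (a : Node h) : node h a 1 = (a.2 : ℝ) / h := rfl

/-- The nodal basis function at the vertex with index `a`. -/
noncomputable def hat (h : ℕ) (a : Node h) (x : E2) : ℝ :=
  refHat (h * x 0 - (a.1 : ℕ)) (h * x 1 - (a.2 : ℕ))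

/-- The finite element function with nodal values `U`. -/
noncomputable def interp (h : ℕ) (U : Node h → ℝ) (x : E2) : ℝ := ∑ a, U a * hat h a x

/-- The nodal values of `u`. -/
noncomputable def nodal (h : ℕ) (u : E2 → ℝ) (a : Node h) : ℝ := u (node h a)

lemma hat_nonneg (h : ℕ) (a : Node h) (x : E2) : 0 ≤ hat h a x := refHat_nonneg _ _

lemma hat_le_one (h : ℕ) (a : Node h) (x : E2) : hat h a x ≤ 1 := refHat_le_one _ _

lemma continuous_hat (h : ℕ) (a : Node h) : Continuous (hat h a) := by
  have h0 := continuous_coord 0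
  have h1 := continuous_coord 1
  unfold hat refHat
  fun_prop

lemma continuous_interp (h : ℕ) (U : Node h → ℝ) : Continuous (interp h U) :=
  continuous_finsetSum _ fun a _ => continuous_const.mul (continuous_hat h a)

lemma interp_single (h : ℕ) (a : Node h) : interp h (Pi.single a 1) = hat h a := by
  ext x
  simp [interp, Pi.single_apply]

lemma mem_Kplus_iff {h : ℕ} (hh : 1 ≤ h) (k j : ℕ) (x : E2) :
    x ∈ Kplus h (k + 1) (j + 1) ↔
      0 ≤ h * x 0 - k ∧ 0 ≤ h * x 1 - j ∧ (h * x 0 - k) + (h * x 1 - j) ≤ 1 := by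
  have hpos : (0 : ℝ) < h := by exact_mod_cast hh
  have e1 : (j : ℝ) / h + (((k : ℝ) + 1) / h - x 0) = (j + k + 1) / h - x 0 := by ring
  simp only [Kplus, Set.mem_ofPred_eq, Nat.cast_add, Nat.cast_one, add_sub_cancel_right, e1]
  rw [div_le_iff₀' hpos, le_div_iff₀' hpos, div_le_iff₀' hpos, le_sub_iff_add_le,
    le_div_iff₀' hpos]
  constructor
  · rintro ⟨a, b, c, d⟩
    exact ⟨by linarith, by linarith, by linarith⟩
  · rintro ⟨a, b, c⟩
    exact ⟨by linarith, by linarith, by linarith, by linarith⟩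

lemma mem_Kminus_iff {h : ℕ} (hh : 1 ≤ h) (k j : ℕ) (x : E2) :
    x ∈ Kminus h (k + 1) (j + 1) ↔
      0 ≤ k + 1 - h * x 0 ∧ 0 ≤ j + 1 - h * x 1 ∧ (k + 1 - h * x 0) + (j + 1 - h * x 1) ≤ 1 := by
  have hpos : (0 : ℝ) < h := by exact_mod_cast hh
  have e1 : ((j : ℝ) + 1) / h + ((k : ℝ) / h - x 0) = (j + k + 1) / h - x 0 := by ring
  simp only [Kminus, Set.mem_ofPred_eq, Nat.cast_add, Nat.cast_one, add_sub_cancel_right, e1]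
  rw [div_le_iff₀' hpos, le_div_iff₀' hpos, le_div_iff₀' hpos, sub_le_iff_le_add,
    div_le_iff₀' hpos]
  constructor
  · rintro ⟨a, b, c, d⟩
    exact ⟨by linarith, by linarith, by linarith⟩
  · rintro ⟨a, b, c⟩
    exact ⟨by linarith, by linarith, by linarith, by linarith⟩

lemma interp_of_mem_Kplus {h : ℕ} (hh : 1 ≤ h) (U : Node h → ℝ) (k j : Fin h) {x : E2}
    (hx : x ∈ Kplus h (k + 1) (j + 1)) :
    interp h U x = U (k.castSucc, j.castSucc) * (1 - (h * x 0 - k) - (h * x 1 - j))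
      + U (k.succ, j.castSucc) * (h * x 0 - k) + U (k.castSucc, j.succ) * (h * x 1 - j) := by
  obtain ⟨hp, hq, hpq⟩ := (mem_Kplus_iff hh k j x).1 hx
  have key (a : Node h) : hat h a x =
      (if a = (k.castSucc, j.castSucc) then 1 - (h * x 0 - k) - (h * x 1 - j) else 0)
      + (if a = (k.succ, j.castSucc) then h * x 0 - k else 0)
      + (if a = (k.castSucc, j.succ) then h * x 1 - j else 0) := by
    have arg (t : ℝ) (m n : ℕ) : t - m = (t - n) - (((m : ℤ) - (n : ℤ) : ℤ) : ℝ) := by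
      push_cast; ring
    rw [hat, arg _ a.1 k, arg _ a.2 j, refHat_sub_intCast hp hq hpq]
    congr! 3 <;> simp only [Prod.ext_iff, Fin.ext_iff, Fin.val_castSucc, Fin.val_succ] <;> omega
  simp only [interp, key, mul_add, Finset.sum_add_distrib, mul_ite, mul_zero, Finset.sum_ite_eq',
    Finset.mem_univ, if_true]

lemma interp_of_mem_Kminus {h : ℕ} (hh : 1 ≤ h) (U : Node h → ℝ) (k j : Fin h) {x : E2}
    (hx : x ∈ Kminus h (k + 1) (j + 1)) :
    interp h U x = U (k.succ, j.succ) * (1 - (k + 1 - h * x 0) - (j + 1 - h * x 1))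
      + U (k.castSucc, j.succ) * (k + 1 - h * x 0)
      + U (k.succ, j.castSucc) * (j + 1 - h * x 1) := by
  obtain ⟨hp, hq, hpq⟩ := (mem_Kminus_iff hh k j x).1 hx
  have key (a : Node h) : hat h a x =
      (if a = (k.succ, j.succ) then 1 - (k + 1 - h * x 0) - (j + 1 - h * x 1) else 0)
      + (if a = (k.castSucc, j.succ) then k + 1 - h * x 0 else 0)
      + (if a = (k.succ, j.castSucc) then j + 1 - h * x 1 else 0) := by
    have arg (t : ℝ) (m n : ℕ) :
        -(t - m) = (n + 1 - t) - (((n : ℤ) + 1 - (m : ℤ) : ℤ) : ℝ) := by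
      push_cast; ring
    rw [hat, ← refHat_neg, arg _ a.1 k, arg _ a.2 j, refHat_sub_intCast hp hq hpq]
    congr! 3 <;> simp only [Prod.ext_iff, Fin.ext_iff, Fin.val_castSucc, Fin.val_succ] <;> omega
  simp only [interp, key, mul_add, Finset.sum_add_distrib, mul_ite, mul_zero, Finset.sum_ite_eq',
    Finset.mem_univ, if_true]

lemma exists_fin_between {h : ℕ} (hh : 1 ≤ h) {t : ℝ} (h0 : 0 ≤ t) (h1 : t ≤ h) :
    ∃ k : Fin h, (k : ℝ) ≤ t ∧ t ≤ k + 1 := by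
  rcases h1.lt_or_eq with hlt | rfl
  · exact ⟨⟨⌊t⌋₊, (Nat.floor_lt h0).2 hlt⟩, Nat.floor_le h0, (Nat.lt_floor_add_one t).le⟩
  · refine ⟨⟨h - 1, by omega⟩, ?_, ?_⟩ <;> simp [Nat.cast_sub hh]

lemma exists_triangle {h : ℕ} (hh : 1 ≤ h) {x : E2} (hx : x ∈ OmegaCl) :
    ∃ k j : Fin h, x ∈ Kplus h (k + 1) (j + 1) ∨ x ∈ Kminus h (k + 1) (j + 1) := by
  have hpos : (0 : ℝ) < h := by exact_mod_cast hh
  obtain ⟨⟨a0, a1⟩, ⟨b0, b1⟩⟩ := hx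
  obtain ⟨k, hk0, hk1⟩ := exists_fin_between hh (mul_nonneg hpos.le a0)
    (mul_le_of_le_one_right hpos.le a1)
  obtain ⟨j, hj0, hj1⟩ := exists_fin_between hh (mul_nonneg hpos.le b0)
    (mul_le_of_le_one_right hpos.le b1)
  refine ⟨k, j, ?_⟩
  rw [mem_Kplus_iff hh, mem_Kminus_iff hh]
  rcases le_total ((h * x 0 - k) + (h * x 1 - j)) 1 with hle | hle
  · exact Or.inl ⟨by linarith, by linarith, hle⟩
  · exact Or.inr ⟨by linarith, by linarith, by linarith⟩

lemma node_mem_OmegaCl {h : ℕ} (hh : 1 ≤ h) (a : Node h) : node h a ∈ OmegaCl := by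
  have hpos : (0 : ℝ) < h := by exact_mod_cast hh
  have key (i : Fin (h + 1)) : ((i : ℕ) : ℝ) / h ∈ Set.Icc (0 : ℝ) 1 :=
    ⟨by positivity, (div_le_one hpos).2 (by exact_mod_cast i.is_le)⟩
  exact ⟨key a.1, key a.2⟩

lemma memF_interp {h : ℕ} (hh : 1 ≤ h) (U : Node h → ℝ) : MemF h (interp h U) := by
  refine ⟨(continuous_interp h U).continuousOn, fun k j hk hkh hj hjh => ?_⟩
  obtain ⟨k, rfl⟩ := Nat.exists_eq_add_of_le' hk
  obtain ⟨j, rfl⟩ := Nat.exists_eq_add_of_le' hj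
  have hplus := fun x => interp_of_mem_Kplus hh U ⟨k, hkh⟩ ⟨j, hjh⟩ (x := x)
  have hminus := fun x => interp_of_mem_Kminus hh U ⟨k, hkh⟩ ⟨j, hjh⟩ (x := x)
  constructor
  · set A := U (Fin.castSucc ⟨k, hkh⟩, Fin.castSucc ⟨j, hjh⟩)
    set B := U (Fin.succ ⟨k, hkh⟩, Fin.castSucc ⟨j, hjh⟩)
    set C := U (Fin.castSucc ⟨k, hkh⟩, Fin.succ ⟨j, hjh⟩)
    refine ⟨vtx (h * (B - A)) (h * (C - A)), A * (1 + k + j) - B * k - C * j, fun x hx => ?_⟩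
    rw [hplus x hx, inner_eq_coord, vtx_zero, vtx_one]
    ring
  · set A := U (Fin.succ ⟨k, hkh⟩, Fin.succ ⟨j, hjh⟩)
    set B := U (Fin.castSucc ⟨k, hkh⟩, Fin.succ ⟨j, hjh⟩)
    set C := U (Fin.succ ⟨k, hkh⟩, Fin.castSucc ⟨j, hjh⟩)
    refine ⟨vtx (h * (A - B)) (h * (A - C)), A * (1 - (k + 1) - (j + 1)) + B * (k + 1)
      + C * (j + 1), fun x hx => ?_⟩
    rw [hminus x hx, inner_eq_coord, vtx_zero, vtx_one]
    ring

lemma MemF.eq_interp {h : ℕ} (hh : 1 ≤ h) {u : E2 → ℝ} (hu : MemF h u) {x : E2}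
    (hx : x ∈ OmegaCl) : u x = interp h (nodal h u) x := by
  have hpos : (0 : ℝ) < h := by exact_mod_cast hh
  have hne : (h : ℝ) ≠ 0 := hpos.ne'
  have hcancel (t : ℝ) : h * (t / h) = t := by field_simp
  obtain ⟨k, j, hT | hT⟩ := exists_triangle hh hx
  · obtain ⟨b, c, hbc⟩ := (hu.2 (k + 1) (j + 1) (by omega) (by omega) (by omega) (by omega)).1
    have mem (a : Node h) := mem_Kplus_iff hh k j (node h a)
    simp only [node_zero, node_one, hcancel] at mem
    rw [interp_of_mem_Kplus hh _ k j hT]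
    simp only [nodal]
    rw [hbc x hT, hbc (node h _) ((mem (k.castSucc, j.castSucc)).2 (by simp)),
      hbc (node h _) ((mem (k.succ, j.castSucc)).2 (by simp)),
      hbc (node h _) ((mem (k.castSucc, j.succ)).2 (by simp))]
    simp only [inner_eq_coord, node_zero, node_one, Fin.val_castSucc, Fin.val_succ, Nat.cast_add,
      Nat.cast_one]
    field_simp
    ring
  · obtain ⟨b, c, hbc⟩ := (hu.2 (k + 1) (j + 1) (by omega) (by omega) (by omega) (by omega)).2
    have mem (a : Node h) := mem_Kminus_iff hh k j (node h a)
    simp only [node_zero, node_one, hcancel] at mem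
    rw [interp_of_mem_Kminus hh _ k j hT]
    simp only [nodal]
    rw [hbc x hT, hbc (node h _) ((mem (k.succ, j.succ)).2 (by simp)),
      hbc (node h _) ((mem (k.castSucc, j.succ)).2 (by simp)),
      hbc (node h _) ((mem (k.succ, j.castSucc)).2 (by simp))]
    simp only [inner_eq_coord, node_zero, node_one, Fin.val_castSucc, Fin.val_succ, Nat.cast_add,
      Nat.cast_one]
    field_simp
    ring

lemma nodal_interp {h : ℕ} (hh : 1 ≤ h) (U : Node h → ℝ) : nodal h (interp h U) = U := by
  have hne : (h : ℝ) ≠ 0 := by positivity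
  ext b
  have key (a : Node h) : hat h a (node h b) = if b = a then 1 else 0 := by
    have := refHat_sub_intCast le_rfl le_rfl (by norm_num : (0 : ℝ) + 0 ≤ 1)
      ((a.1 : ℕ) - (b.1 : ℕ) : ℤ) ((a.2 : ℕ) - (b.2 : ℕ) : ℤ)
    have e (t : ℝ) : h * (t / h) = t := by field_simp
    rw [hat, node_zero, node_one, e, e]
    convert this using 1
    · congr 1 <;> (push_cast; ring)
    · simp only [sub_zero, ite_self, add_zero]
      congr 1
      simp only [Prod.ext_iff, Fin.ext_iff, eq_iff_iff]
      omega
  simp [nodal, interp, key]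

lemma node_mem_Delta (h : ℕ) (a : Node h) : node h a ∈ Delta h :=
  ⟨a.1, a.2, a.1.is_le, a.2.is_le, rfl⟩

lemma Ph_eq_interp {h : ℕ} (hh : 1 ≤ h) (f : E2 → ℝ) {x : E2} (hx : x ∈ OmegaCl) :
    Ph h f x = interp h (nodal h f) x := by
  have hex : ∃ p, Interpolates h f p := by
    refine ⟨interp h (nodal h f), memF_interp hh _, ?_⟩
    rintro x ⟨k, j, hk, hj, rfl⟩
    exact congrFun (nodal_interp hh (nodal h f)) (⟨k, by omega⟩, ⟨j, by omega⟩)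
  have hs := hex.choose_spec
  rw [Ph, dif_pos hex, hs.1.eq_interp hh hx]
  congr 1
  ext a
  exact hs.2 _ (node_mem_Delta h a)

lemma isOpen_Omega : IsOpen Omega :=
  (isOpen_Ioo.preimage (continuous_coord 0)).inter (isOpen_Ioo.preimage (continuous_coord 1))

lemma Omega_subset_OmegaCl : Omega ⊆ OmegaCl :=
  fun _ hx => ⟨Set.Ioo_subset_Icc_self hx.1, Set.Ioo_subset_Icc_self hx.2⟩

lemma closure_Omega : closure Omega = OmegaCl := by
  apply Set.Subset.antisymm
  · refine closure_minimal Omega_subset_OmegaCl ?_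
    exact (isClosed_Icc.preimage (continuous_coord 0)).inter
      (isClosed_Icc.preimage (continuous_coord 1))
  · intro x hx
    have hlim : Tendsto (fun t : ℝ => (1 - t) • x + t • vtx (1 / 2) (1 / 2))
        (nhdsWithin 0 (Set.Ioo 0 1)) (nhds x) := by
      have hc : Continuous fun t : ℝ => (1 - t) • x + t • vtx (1 / 2) (1 / 2) := by fun_prop
      simpa using (hc.tendsto 0).mono_left nhdsWithin_le_nhds
    have : (nhdsWithin (0 : ℝ) (Set.Ioo 0 1)).NeBot := by
      rw [nhdsWithin_Ioo_eq_nhdsGT one_pos]; infer_instance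
    refine mem_closure_of_tendsto hlim ?_
    filter_upwards [self_mem_nhdsWithin] with t ht
    obtain ⟨⟨a0, a1⟩, ⟨b0, b1⟩⟩ := hx
    obtain ⟨t0, t1⟩ := ht
    refine ⟨⟨?_, ?_⟩, ⟨?_, ?_⟩⟩ <;>
      simp only [PiLp.add_apply, PiLp.smul_apply, smul_eq_mul, vtx_zero, vtx_one] <;> nlinarith

lemma isBounded_Omega : Bornology.IsBounded Omega := by
  refine (Metric.isBounded_ball (x := (0 : E2)) (r := 2)).subset fun x hx => ?_
  rw [mem_ball_zero_iff]
  have hs : ‖x‖ ^ 2 = x 0 ^ 2 + x 1 ^ 2 := by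
    simp [EuclideanSpace.norm_sq_eq, Fin.sum_univ_two]
  obtain ⟨⟨a0, a1⟩, ⟨b0, b1⟩⟩ := hx
  exact lt_of_pow_lt_pow_left₀ 2 (by norm_num) (by nlinarith)

lemma volume_Omega_ne_top : volume Omega ≠ ⊤ := isBounded_Omega.measure_lt_top.ne

lemma forall_le_iff_nodal_le {h : ℕ} (hh : 1 ≤ h) {f g : E2 → ℝ} (hf : MemF h f)
    (hg : MemF h g) : (∀ x ∈ Omega, f x ≤ g x) ↔ ∀ a, nodal h f a ≤ nodal h g a := by
  constructor
  · intro hle a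
    refine le_on_closure hle ?_ ?_ ?_ <;> rw [closure_Omega]
    exacts [hf.1, hg.1, node_mem_OmegaCl hh a]
  · intro hle x hx
    rw [hf.eq_interp hh (Omega_subset_OmegaCl hx), hg.eq_interp hh (Omega_subset_OmegaCl hx)]
    exact Finset.sum_le_sum fun a _ => mul_le_mul_of_nonneg_right (hle a) (hat_nonneg h a x)

lemma memF_const (h : ℕ) (c : ℝ) : MemF h fun _ => c :=
  ⟨continuousOn_const, fun _ _ _ _ _ _ => ⟨⟨0, c, by simp⟩, ⟨0, c, by simp⟩⟩⟩

lemma convex_Kplus (h k j : ℕ) : Convex ℝ (Kplus h k j) := by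
  rintro x ⟨x0, x1, x2, x3⟩ y ⟨y0, y1, y2, y3⟩ a b ha hb hab
  obtain rfl : b = 1 - a := by linarith
  refine ⟨?_, ?_, ?_, ?_⟩ <;>
    simp only [PiLp.add_apply, PiLp.smul_apply, smul_eq_mul] <;> nlinarith

lemma convex_Kminus (h k j : ℕ) : Convex ℝ (Kminus h k j) := by
  rintro x ⟨x0, x1, x2, x3⟩ y ⟨y0, y1, y2, y3⟩ a b ha hb hab
  obtain rfl : b = 1 - a := by linarith
  refine ⟨?_, ?_, ?_, ?_⟩ <;>
    simp only [PiLp.add_apply, PiLp.smul_apply, smul_eq_mul] <;> nlinarith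

lemma grad_of_affine {f : E2 → ℝ} {T : Set E2} {x : E2} (hx : T ∈ nhds x) (α β γ : ℝ)
    (hf : ∀ y ∈ T, f y = α * y 0 + β * y 1 + γ) : grad f x = vtx α β := by
  apply HasGradientAt.gradient
  have hg : HasGradientAt (fun y : E2 => ⟪vtx α β, y⟫ + γ) (vtx α β) x := by
    rw [hasGradientAt_iff_hasFDerivAt]
    exact ((InnerProductSpace.toDual ℝ E2 (vtx α β)).hasFDerivAt).add_const γ
  refine hg.congr_of_eventuallyEq ?_
  filter_upwards [hx] with y hy
  rw [hf y hy, inner_eq_coord, vtx_zero, vtx_one]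

lemma grad_interp_of_mem_nhds_Kplus {h : ℕ} (hh : 1 ≤ h) (U : Node h → ℝ) (k j : Fin h) {x : E2}
    (hx : Kplus h (k + 1) (j + 1) ∈ nhds x) :
    grad (interp h U) x = vtx (h * (U (k.succ, j.castSucc) - U (k.castSucc, j.castSucc)))
      (h * (U (k.castSucc, j.succ) - U (k.castSucc, j.castSucc))) := by
  refine grad_of_affine hx _ _ (U (k.castSucc, j.castSucc) * (1 + k + j)
    - U (k.succ, j.castSucc) * k - U (k.castSucc, j.succ) * j) fun y hy => ?_
  rw [interp_of_mem_Kplus hh U k j hy]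
  ring

lemma grad_interp_of_mem_nhds_Kminus {h : ℕ} (hh : 1 ≤ h) (U : Node h → ℝ) (k j : Fin h) {x : E2}
    (hx : Kminus h (k + 1) (j + 1) ∈ nhds x) :
    grad (interp h U) x = vtx (h * (U (k.succ, j.succ) - U (k.castSucc, j.succ)))
      (h * (U (k.succ, j.succ) - U (k.succ, j.castSucc))) := by
  refine grad_of_affine hx _ _ (U (k.succ, j.succ) * (1 - (k + 1) - (j + 1))
    + U (k.castSucc, j.succ) * (k + 1) + U (k.succ, j.castSucc) * (j + 1)) fun y hy => ?_
  rw [interp_of_mem_Kminus hh U k j hy]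
  ring

lemma ae_exists_grad_interp_eq {h : ℕ} (hh : 1 ≤ h) :
    ∀ᵐ x ∂(volume : Measure E2).restrict Omega, ∃ a b c d : Node h, ∀ U : Node h → ℝ,
      grad (interp h U) x = vtx (h * (U a - U b)) (h * (U c - U d)) := by
  have hfr {s : Set E2} (hs : Convex ℝ s) :
      ∀ᵐ x ∂(volume : Measure E2).restrict Omega, x ∉ frontier s :=
    ae_restrict_of_ae (measure_eq_zero_iff_ae_notMem.1 (hs.addHaar_frontier volume))
  filter_upwards [ae_restrict_mem isOpen_Omega.measurableSet,
    ae_all_iff.2 fun k : Fin h => ae_all_iff.2 fun j : Fin h =>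
      hfr (convex_Kplus h (k + 1) (j + 1)),
    ae_all_iff.2 fun k : Fin h => ae_all_iff.2 fun j : Fin h =>
      hfr (convex_Kminus h (k + 1) (j + 1))] with x hx h1 h2
  have hint {s : Set E2} (hs : x ∈ s) (hf : x ∉ frontier s) : s ∈ nhds x := by
    by_contra hn
    exact hf ⟨subset_closure hs, fun hi => hn (mem_interior_iff_mem_nhds.1 hi)⟩
  obtain ⟨k, j, hT | hT⟩ := exists_triangle hh (Omega_subset_OmegaCl hx)
  · exact ⟨_, _, _, _, fun U =>
      grad_interp_of_mem_nhds_Kplus hh U k j (hint hT (h1 k j))⟩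
  · exact ⟨_, _, _, _, fun U =>
      grad_interp_of_mem_nhds_Kminus hh U k j (hint hT (h2 k j))⟩

lemma ae_grad_interp_eq_sum {h : ℕ} (hh : 1 ≤ h) :
    ∀ᵐ x ∂(volume : Measure E2).restrict Omega, ∀ U : Node h → ℝ,
      grad (interp h U) x = ∑ a, U a • grad (hat h a) x := by
  filter_upwards [ae_exists_grad_interp_eq hh] with x ⟨a, b, c, d, hx⟩ U
  rw [hx U]
  simp only [← interp_single, hx]
  ext i
  fin_cases i <;>
    simp [Pi.single_apply, Finset.sum_apply, mul_sub, Finset.sum_sub_distrib, mul_comm] <;> ring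

lemma measurable_grad (f : E2 → ℝ) : Measurable (grad f) :=
  (InnerProductSpace.toDual ℝ E2).symm.continuous.measurable.comp (measurable_fderiv ℝ f)

lemma ae_norm_grad_hat_le {h : ℕ} (hh : 1 ≤ h) (e : Node h) :
    ∀ᵐ x ∂(volume : Measure E2).restrict Omega, ‖grad (hat h e) x‖ ≤ 2 * h := by
  filter_upwards [ae_exists_grad_interp_eq hh] with x ⟨a, b, c, d, hx⟩
  have hs (a b : Node h) :
      ((Pi.single e 1 : Node h → ℝ) a - (Pi.single e 1 : Node h → ℝ) b) ^ 2 ≤ 1 := by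
    simp only [Pi.single_apply]
    split_ifs <;> norm_num
  refine le_of_sq_le_sq ?_ (by positivity)
  rw [← interp_single, hx, norm_vtx_sq]
  nlinarith [hs a b, hs c d, sq_nonneg (h : ℝ)]

lemma integrable_mul_inner_grad_hat {h : ℕ} (hh : 1 ≤ h) {ψ : E2 → ℝ} (hψ : Continuous ψ)
    (hψ0 : ∀ x, 0 ≤ ψ x) (hψ1 : ∀ x, ψ x ≤ 1) (a b : Node h) :
    IntegrableOn (fun x => ψ x * ⟪grad (hat h a) x, grad (hat h b) x⟫) Omega := by
  refine Measure.integrableOn_of_bounded (M := (2 * h) * (2 * h)) volume_Omega_ne_top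
    (hψ.measurable.mul
      ((measurable_grad _).inner (measurable_grad _))).aestronglyMeasurable ?_
  filter_upwards [ae_norm_grad_hat_le hh a, ae_norm_grad_hat_le hh b] with x ha hb
  rw [norm_mul, Real.norm_of_nonneg (hψ0 x)]
  calc ψ x * ‖⟪grad (hat h a) x, grad (hat h b) x⟫‖
      ≤ 1 * (‖grad (hat h a) x‖ * ‖grad (hat h b) x‖) :=
        mul_le_mul (hψ1 x) (norm_inner_le_norm _ _) (norm_nonneg _) zero_le_one
    _ ≤ _ := by rw [one_mul]; gcongr

/-- The Dirichlet energy, with weight `ψ`, of the finite element function with nodal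
values `U`. -/
noncomputable def weightedEnergy (h : ℕ) (ψ : E2 → ℝ) (U : Node h → ℝ) : ℝ :=
  ∫ x in Omega, ψ x * ‖grad (interp h U) x‖ ^ 2

lemma ae_mul_norm_grad_sq_eq_sum {h : ℕ} (hh : 1 ≤ h) (ψ : E2 → ℝ) (U : Node h → ℝ) :
    (fun x => ψ x * ‖grad (interp h U) x‖ ^ 2) =ᵐ[(volume : Measure E2).restrict Omega]
      fun x => ∑ a, ∑ b, U a * U b * (ψ x * ⟪grad (hat h a) x, grad (hat h b) x⟫) := by
  filter_upwards [ae_grad_interp_eq_sum hh] with x hx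
  rw [hx U, ← real_inner_self_eq_norm_sq]
  simp only [sum_inner, inner_sum, real_inner_smul_left, real_inner_smul_right, Finset.mul_sum]
  exact Finset.sum_congr rfl fun a _ => Finset.sum_congr rfl fun b _ => by
    rw [real_inner_comm]; ring

lemma integrable_mul_norm_grad_sq {h : ℕ} (hh : 1 ≤ h) {ψ : E2 → ℝ} (hψ : Continuous ψ)
    (hψ0 : ∀ x, 0 ≤ ψ x) (hψ1 : ∀ x, ψ x ≤ 1) (U : Node h → ℝ) :
    IntegrableOn (fun x => ψ x * ‖grad (interp h U) x‖ ^ 2) Omega :=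
  (integrable_finsetSum _ fun a _ => integrable_finsetSum _ fun b _ =>
    (integrable_mul_inner_grad_hat hh hψ hψ0 hψ1 a b).const_mul _).congr
    (ae_mul_norm_grad_sq_eq_sum hh ψ U).symm

lemma weightedEnergy_eq_sum {h : ℕ} (hh : 1 ≤ h) {ψ : E2 → ℝ} (hψ : Continuous ψ)
    (hψ0 : ∀ x, 0 ≤ ψ x) (hψ1 : ∀ x, ψ x ≤ 1) (U : Node h → ℝ) :
    weightedEnergy h ψ U = ∑ a, ∑ b, U a * U b *
      ∫ x in Omega, ψ x * ⟪grad (hat h a) x, grad (hat h b) x⟫ := by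
  have hint a b := (integrable_mul_inner_grad_hat hh hψ hψ0 hψ1 a b).const_mul (U a * U b)
  rw [weightedEnergy, integral_congr_ae (ae_mul_norm_grad_sq_eq_sum hh ψ U),
    integral_finsetSum _ fun a _ => integrable_finsetSum _ fun b _ => hint a b]
  refine Finset.sum_congr rfl fun a _ => ?_
  rw [integral_finsetSum _ fun b _ => hint a b]
  exact Finset.sum_congr rfl fun b _ => integral_const_mul _ _

lemma weightedEnergy_nonneg {h : ℕ} {ψ : E2 → ℝ} (hψ0 : ∀ x, 0 ≤ ψ x) (U : Node h → ℝ) :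
    0 ≤ weightedEnergy h ψ U :=
  integral_nonneg fun x => mul_nonneg (hψ0 x) (sq_nonneg _)

lemma continuous_weightedEnergy {h : ℕ} (hh : 1 ≤ h) {ψ : E2 → ℝ} (hψ : Continuous ψ)
    (hψ0 : ∀ x, 0 ≤ ψ x) (hψ1 : ∀ x, ψ x ≤ 1) : Continuous (weightedEnergy h ψ) := by
  rw [funext (weightedEnergy_eq_sum hh hψ hψ0 hψ1)]
  fun_prop

lemma weightedEnergy_parallelogram {h : ℕ} (hh : 1 ≤ h) {ψ : E2 → ℝ} (hψ : Continuous ψ)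
    (hψ0 : ∀ x, 0 ≤ ψ x) (hψ1 : ∀ x, ψ x ≤ 1) (U V : Node h → ℝ) :
    weightedEnergy h ψ (fun a => (U a + V a) / 2) + weightedEnergy h ψ (fun a => U a - V a) / 4
      = (weightedEnergy h ψ U + weightedEnergy h ψ V) / 2 := by
  simp only [weightedEnergy_eq_sum hh hψ hψ0 hψ1, ← Finset.sum_add_distrib, Finset.sum_div]
  exact Finset.sum_congr rfl fun a _ => Finset.sum_congr rfl fun b _ => by ring

lemma weightedEnergy_one_comp_le {h : ℕ} (hh : 1 ≤ h) {τ : ℝ → ℝ}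
    (hτ : ∀ s t, |τ s - τ t| ≤ |s - t|) (U : Node h → ℝ) :
    weightedEnergy h (fun _ => 1) (fun a => τ (U a)) ≤ weightedEnergy h (fun _ => 1) U := by
  have hint := integrable_mul_norm_grad_sq hh (ψ := fun _ => (1 : ℝ)) continuous_const
    (fun _ => zero_le_one) (fun _ => le_rfl)
  refine integral_mono_ae (hint _) (hint _) ?_
  filter_upwards [ae_exists_grad_interp_eq hh] with x ⟨a, b, c, d, hx⟩
  simp only [hx, norm_vtx_sq, mul_pow, one_mul]
  exact add_le_add (mul_le_mul_of_nonneg_left (sq_le_sq.2 (hτ _ _)) (sq_nonneg _))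
    (mul_le_mul_of_nonneg_left (sq_le_sq.2 (hτ _ _)) (sq_nonneg _))

lemma exists_sq_sub_le_weightedEnergy_one {h : ℕ} (hh : 1 ≤ h) (k j : Fin h) :
    ∃ c > 0, ∀ U : Node h → ℝ,
      c * (U (k.succ, j.castSucc) - U (k.castSucc, j.castSucc)) ^ 2
        ≤ weightedEnergy h (fun _ => 1) U := by
  have hpos : (0 : ℝ) < h := by exact_mod_cast hh
  set O : Set E2 := {x | 0 < h * x 0 - k ∧ 0 < h * x 1 - j ∧
    (h * x 0 - k) + (h * x 1 - j) < 1} with hO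
  have hc0 := continuous_coord 0
  have hc1 := continuous_coord 1
  have hOo : IsOpen O :=
    (isOpen_lt continuous_const (by fun_prop : Continuous fun x : E2 => h * x 0 - k)).inter
      ((isOpen_lt continuous_const (by fun_prop : Continuous fun x : E2 => h * x 1 - j)).inter
        (isOpen_lt (by fun_prop : Continuous fun x : E2 => (h * x 0 - k) + (h * x 1 - j))
          continuous_const))
  have hOT : O ⊆ Kplus h (k + 1) (j + 1) := fun x hx =>
    (mem_Kplus_iff hh k j x).2 ⟨hx.1.le, hx.2.1.le, hx.2.2.le⟩
  have hOΩ : O ⊆ Omega := by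
    rintro x ⟨h1, h2, h3⟩
    have hk : (k : ℝ) + 1 ≤ h := by exact_mod_cast k.2
    have hj : (j : ℝ) + 1 ≤ h := by exact_mod_cast j.2
    have hk0 : (0 : ℝ) ≤ k := by positivity
    have hj0 : (0 : ℝ) ≤ j := by positivity
    refine ⟨⟨?_, ?_⟩, ⟨?_, ?_⟩⟩ <;> nlinarith
  have hOne : O.Nonempty := by
    refine ⟨vtx ((k + 1 / 4) / h) ((j + 1 / 4) / h), ?_⟩
    simp only [hO, Set.mem_ofPred_eq, vtx_zero, vtx_one, mul_div_cancel₀ _ hpos.ne']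
    norm_num
  have hvol : 0 < (volume : Measure E2).real O :=
    ENNReal.toReal_pos (hOo.measure_pos volume hOne).ne'
      (measure_ne_top_of_subset hOΩ volume_Omega_ne_top)
  refine ⟨(volume : Measure E2).real O * (h : ℝ) ^ 2, by positivity, fun U => ?_⟩
  have hint := integrable_mul_norm_grad_sq hh (ψ := fun _ => (1 : ℝ)) continuous_const
    (fun _ => zero_le_one) (fun _ => le_rfl) U
  calc _ ≤ ∫ x in O, (h * (U (k.succ, j.castSucc) - U (k.castSucc, j.castSucc))) ^ 2
          + (h * (U (k.castSucc, j.succ) - U (k.castSucc, j.castSucc))) ^ 2 := by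
        rw [setIntegral_const, smul_eq_mul, mul_assoc, ← mul_pow]
        gcongr
        exact le_add_of_nonneg_right (sq_nonneg _)
    _ = ∫ x in O, 1 * ‖grad (interp h U) x‖ ^ 2 := by
        refine setIntegral_congr_fun hOo.measurableSet fun x hx => ?_
        simp only [grad_interp_of_mem_nhds_Kplus hh U k j
          (mem_of_superset (hOo.mem_nhds hx) hOT), norm_vtx_sq, one_mul]
    _ ≤ _ := setIntegral_mono_set hint (ae_of_all _ fun x => by positivity)
        hOΩ.eventuallyLE

lemma integrableOn_Omega_of_continuous {f : E2 → ℝ} (hf : Continuous f) :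
    IntegrableOn f Omega := by
  have hc : IsCompact (closure Omega) := isBounded_Omega.isCompact_closure
  exact (hf.continuousOn.integrableOn_compact hc).mono_set subset_closure

/-- The integral over `Ω` of the nodal basis function with index `a`. -/
noncomputable def mass (h : ℕ) (a : Node h) : ℝ := ∫ x in Omega, hat h a x

lemma mass_pos {h : ℕ} (hh : 1 ≤ h) (a : Node h) : 0 < mass h a := by
  rw [mass, setIntegral_pos_iff_support_of_nonneg_ae (ae_of_all _ (hat_nonneg h a))
    (integrableOn_Omega_of_continuous (continuous_hat h a))]
  have hone : hat h a (node h a) = 1 := by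
    have := congrFun (nodal_interp hh (Pi.single a 1)) a
    rwa [interp_single, Pi.single_eq_same] at this
  have hopen : IsOpen (Function.support (hat h a)) := (continuous_hat h a).isOpen_support
  have hcl : node h a ∈ closure Omega := closure_Omega ▸ node_mem_OmegaCl hh a
  refine (hopen.inter isOpen_Omega).measure_pos volume ?_
  exact mem_closure_iff.1 hcl _ hopen (by simp [hone])

lemma MemF.grad_eq {h : ℕ} (hh : 1 ≤ h) {u : E2 → ℝ} (hu : MemF h u) {x : E2}
    (hx : x ∈ Omega) : grad u x = grad (interp h (nodal h u)) x := by
  refine Filter.EventuallyEq.gradient_eq ?_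
  filter_upwards [isOpen_Omega.mem_nhds hx] with y hy
  exact hu.eq_interp hh (Omega_subset_OmegaCl hy)

lemma MemF.sub {h : ℕ} {u v : E2 → ℝ} (hu : MemF h u) (hv : MemF h v) :
    MemF h fun x => u x - v x := by
  have haff {S : Set E2} (h1 : IsAffineOn u S) (h2 : IsAffineOn v S) :
      IsAffineOn (fun x => u x - v x) S := by
    obtain ⟨b, c, hbc⟩ := h1
    obtain ⟨b', c', hbc'⟩ := h2
    refine ⟨b - b', c - c', fun x hx => ?_⟩
    simp only [hbc x hx, hbc' x hx, inner_sub_left]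
    ring
  exact ⟨hu.1.sub hv.1, fun k j h1 h2 h3 h4 =>
    ⟨haff (hu.2 k j h1 h2 h3 h4).1 (hv.2 k j h1 h2 h3 h4).1,
      haff (hu.2 k j h1 h2 h3 h4).2 (hv.2 k j h1 h2 h3 h4).2⟩⟩

/-- The elastic part of the energy (up to the factor `1 / 2`), in terms of nodal values. -/
noncomputable def elastic (h : ℕ) (η : ℝ) (U V : Node h → ℝ) : ℝ :=
  ∑ e, V e ^ 2 * weightedEnergy h (hat h e) U + η * weightedEnergy h (fun _ => 1) U

/-- The energy `J_h` in terms of nodal values. -/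
noncomputable def energy (h : ℕ) (η : ℝ) (U V : Node h → ℝ) : ℝ :=
  (1 / 2) * elastic h η U V + (1 / 2) * weightedEnergy h (fun _ => 1) V
    + (1 / 2) * ∑ e, (1 - V e) ^ 2 * mass h e

lemma Jh_eq_energy {h : ℕ} (hh : 1 ≤ h) (η : ℝ) {u v : E2 → ℝ} (hu : MemF h u)
    (hv : MemF h v) : Jh h η u v = energy h η (nodal h u) (nodal h v) := by
  have hm := isOpen_Omega.measurableSet
  have hint (e : Node h) := integrable_mul_norm_grad_sq hh (continuous_hat h e) (hat_nonneg h e)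
    (hat_le_one h e) (nodal h u)
  have hint1 := integrable_mul_norm_grad_sq hh (ψ := fun _ => (1 : ℝ)) continuous_const
    (fun _ => zero_le_one) (fun _ => le_rfl) (nodal h u)
  have e1 : ∫ x in Omega, ((Ph h (fun y => (v y) ^ 2) x + η) * ‖grad u x‖ ^ 2)
      = elastic h η (nodal h u) (nodal h v) := by
    have hc : ∫ x in Omega, ((Ph h (fun y => (v y) ^ 2) x + η) * ‖grad u x‖ ^ 2) =
        ∫ x in Omega, (∑ e, nodal h v e ^ 2 * (hat h e x * ‖grad (interp h (nodal h u)) x‖ ^ 2)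
          + η * (1 * ‖grad (interp h (nodal h u)) x‖ ^ 2)) := by
      refine setIntegral_congr_fun hm fun x hx => ?_
      simp only [Ph_eq_interp hh _ (Omega_subset_OmegaCl hx), hu.grad_eq hh hx, interp, add_mul,
        Finset.sum_mul, one_mul, mul_assoc]
      rfl
    rw [hc, integral_add (integrable_finsetSum _ fun e _ => (hint e).const_mul _)
      (hint1.const_mul _), integral_finsetSum _ fun e _ => (hint e).const_mul _]
    simp only [integral_const_mul, elastic, weightedEnergy, one_mul]
  have e2 : ∫ x in Omega, ‖grad v x‖ ^ 2 = weightedEnergy h (fun _ => 1) (nodal h v) := by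
    refine setIntegral_congr_fun hm fun x hx => ?_
    simp only [hv.grad_eq hh hx, one_mul]
  have e3 : ∫ x in Omega, Ph h (fun y => (1 - v y) ^ 2) x
      = ∑ e, (1 - nodal h v e) ^ 2 * mass h e := by
    rw [setIntegral_congr_fun hm fun x hx => Ph_eq_interp hh _ (Omega_subset_OmegaCl hx)]
    simp only [interp]
    rw [integral_finsetSum _ fun e _ =>
      (integrableOn_Omega_of_continuous (continuous_hat h e)).const_mul _]
    simp only [integral_const_mul]
    rfl
  rw [Jh, e1, e2, e3, energy]

lemma H1normSq_eq {h : ℕ} (hh : 1 ≤ h) {u : E2 → ℝ} (hu : MemF h u) :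
    H1normSq u = ∑ a, ∑ b, nodal h u a * nodal h u b * (∫ x in Omega, hat h a x * hat h b x)
      + weightedEnergy h (fun _ => 1) (nodal h u) := by
  have hint (a b : Node h) : IntegrableOn
      (fun x => nodal h u a * nodal h u b * (hat h a x * hat h b x)) Omega :=
    (integrableOn_Omega_of_continuous
      ((continuous_hat h a).mul (continuous_hat h b))).const_mul _
  have hc : H1normSq u = ∫ x in Omega,
      ((∑ a, ∑ b, nodal h u a * nodal h u b * (hat h a x * hat h b x))
        + 1 * ‖grad (interp h (nodal h u)) x‖ ^ 2) := by
    refine setIntegral_congr_fun isOpen_Omega.measurableSet fun x hx => ?_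
    simp only [hu.grad_eq hh hx, one_mul]
    rw [hu.eq_interp hh (Omega_subset_OmegaCl hx), interp, sq, Finset.sum_mul_sum]
    congr 1
    exact Finset.sum_congr rfl fun a _ => Finset.sum_congr rfl fun b _ => by ring
  rw [hc, integral_add (integrable_finsetSum _ fun a _ => integrable_finsetSum _ fun b _ =>
    hint a b) (integrable_mul_norm_grad_sq hh (ψ := fun _ => (1 : ℝ)) continuous_const
      (fun _ => zero_le_one) (fun _ => le_rfl) _),
    integral_finsetSum _ fun a _ => integrable_finsetSum _ fun b _ => hint a b]
  simp only [integral_finsetSum _ fun b _ => hint _ b, integral_const_mul, weightedEnergy, one_mul]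

lemma tendstoF_of_tendsto_nodal {h : ℕ} (hh : 1 ≤ h) {u : ℕ → E2 → ℝ} {ub : E2 → ℝ}
    (hu : ∀ᶠ j in atTop, MemF h (u j)) (hub : MemF h ub)
    (hlim : ∀ a, Tendsto (fun j => nodal h (u j) a) atTop (nhds (nodal h ub a))) :
    TendstoF u ub := by
  set F : (Node h → ℝ) → ℝ := fun U =>
    ∑ a, ∑ b, U a * U b * (∫ x in Omega, hat h a x * hat h b x)
      + weightedEnergy h (fun _ => 1) U with hF
  have hcont : Continuous F := by
    have := continuous_weightedEnergy hh (ψ := fun _ => (1 : ℝ)) continuous_const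
      (fun _ => zero_le_one) (fun _ => le_rfl)
    fun_prop
  have hF0 : F 0 = 0 := by
    simp [hF, weightedEnergy_eq_sum hh (ψ := fun _ => (1 : ℝ)) continuous_const
      (fun _ => zero_le_one) (fun _ => le_rfl)]
  have hlim' : Tendsto (fun j a => nodal h (u j) a - nodal h ub a) atTop
      (nhds (0 : Node h → ℝ)) := by
    rw [tendsto_pi_nhds]
    intro a
    simpa using (hlim a).sub_const (nodal h ub a)
  have := (hcont.tendsto 0).comp hlim'
  rw [hF0] at this
  refine this.congr' ?_
  filter_upwards [hu] with j hj
  rw [H1normSq_eq hh (hj.sub hub)]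
  rfl

lemma continuous_elastic {h : ℕ} (hh : 1 ≤ h) (η : ℝ) :
    Continuous fun p : (Node h → ℝ) × (Node h → ℝ) => elastic h η p.1 p.2 := by
  have h1 := continuous_weightedEnergy hh (ψ := fun _ => (1 : ℝ)) continuous_const
    (fun _ => zero_le_one) (fun _ => le_rfl)
  have h2 (e : Node h) := continuous_weightedEnergy hh (continuous_hat h e) (hat_nonneg h e)
    (hat_le_one h e)
  unfold elastic
  fun_prop

lemma continuous_energy {h : ℕ} (hh : 1 ≤ h) (η : ℝ) :
    Continuous fun p : (Node h → ℝ) × (Node h → ℝ) => energy h η p.1 p.2 := by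
  have h1 := continuous_weightedEnergy hh (ψ := fun _ => (1 : ℝ)) continuous_const
    (fun _ => zero_le_one) (fun _ => le_rfl)
  have h2 := continuous_elastic hh η
  unfold energy
  fun_prop

lemma elastic_nonneg {h : ℕ} {η : ℝ} (hη : 0 < η) (U V : Node h → ℝ) :
    0 ≤ elastic h η U V :=
  add_nonneg (Finset.sum_nonneg fun e _ =>
    mul_nonneg (sq_nonneg _) (weightedEnergy_nonneg (hat_nonneg h e) U))
    (mul_nonneg hη.le (weightedEnergy_nonneg (fun _ => zero_le_one) U))

lemma elastic_mono {h : ℕ} (η : ℝ) (U : Node h → ℝ) {V V' : Node h → ℝ}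
    (h0 : ∀ a, 0 ≤ V a) (hle : ∀ a, V a ≤ V' a) : elastic h η U V ≤ elastic h η U V' := by
  unfold elastic
  gcongr with e _
  · exact weightedEnergy_nonneg (hat_nonneg h e) U
  · exact h0 e
  · exact hle e

lemma elastic_parallelogram {h : ℕ} (hh : 1 ≤ h) {η : ℝ} (U U' V : Node h → ℝ) :
    elastic h η (fun a => (U a + U' a) / 2) V + elastic h η (fun a => U a - U' a) V / 4
      = (elastic h η U V + elastic h η U' V) / 2 := by
  have h1 := weightedEnergy_parallelogram hh (ψ := fun _ => (1 : ℝ)) continuous_const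
    (fun _ => zero_le_one) (fun _ => le_rfl) U U'
  have h2 : (∑ e, V e ^ 2 * weightedEnergy h (hat h e) fun a => (U a + U' a) / 2)
      + (∑ e, V e ^ 2 * weightedEnergy h (hat h e) fun a => U a - U' a) / 4
      = ((∑ e, V e ^ 2 * weightedEnergy h (hat h e) U)
        + ∑ e, V e ^ 2 * weightedEnergy h (hat h e) U') / 2 := by
    simp only [Finset.sum_div, ← Finset.sum_add_distrib]
    refine Finset.sum_congr rfl fun e _ => ?_
    linear_combination V e ^ 2 * weightedEnergy_parallelogram hh (continuous_hat h e)
      (hat_nonneg h e) (hat_le_one h e) U U'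
  unfold elastic
  linear_combination h2 + η * h1

lemma sq_one_sub_le_of_energy_le_comp {h : ℕ} (hh : 1 ≤ h) {η : ℝ} {τ : ℝ → ℝ}
    (hτ : ∀ s t, |τ s - τ t| ≤ |s - t|) (hsq : ∀ t, τ t ^ 2 ≤ t ^ 2)
    (hone : ∀ t, (1 - τ t) ^ 2 ≤ (1 - t) ^ 2) {U V : Node h → ℝ}
    (hle : energy h η U V ≤ energy h η U fun a => τ (V a)) (a : Node h) :
    (1 - V a) ^ 2 ≤ (1 - τ (V a)) ^ 2 := by
  by_contra! hlt
  have h1 : ∑ e, (1 - τ (V e)) ^ 2 * mass h e < ∑ e, (1 - V e) ^ 2 * mass h e :=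
    Finset.sum_lt_sum (fun e _ => mul_le_mul_of_nonneg_right (hone _) (mass_pos hh e).le)
      ⟨a, Finset.mem_univ a, mul_lt_mul_of_pos_right hlt (mass_pos hh a)⟩
  have h2 := weightedEnergy_one_comp_le hh hτ V
  have h3 : elastic h η U (fun a => τ (V a)) ≤ elastic h η U V := by
    refine add_le_add_left (Finset.sum_le_sum fun e _ => ?_) _
    exact mul_le_mul_of_nonneg_right (hsq _) (weightedEnergy_nonneg (hat_nonneg h e) U)
  unfold energy at hle
  linarith

lemma nonneg_of_energy_le {h : ℕ} (hh : 1 ≤ h) {η : ℝ} {U V V₀ : Node h → ℝ}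
    (h0 : ∀ a, 0 ≤ V₀ a) (hV : ∀ a, V a ≤ V₀ a)
    (hmin : ∀ V' : Node h → ℝ, (∀ a, V' a ≤ V₀ a) → energy h η U V ≤ energy h η U V')
    (a : Node h) : 0 ≤ V a := by
  have := sq_one_sub_le_of_energy_le_comp hh (τ := fun t => max t 0)
    (fun s t => abs_max_sub_max_le_abs s t 0)
    (fun t => by rcases le_total t 0 with ht | ht <;> simp [ht, sq_nonneg])
    (fun t => by
      rcases le_total t 0 with ht | ht
      · rw [max_eq_right ht]; nlinarith
      · rw [max_eq_left ht])
    (hmin _ fun a => max_le (hV a) (h0 a)) a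
  by_contra! hlt
  rw [max_eq_right hlt.le] at this
  nlinarith

lemma le_one_of_energy_le {h : ℕ} (hh : 1 ≤ h) {η : ℝ} {U V V₀ : Node h → ℝ}
    (hV : ∀ a, V a ≤ V₀ a)
    (hmin : ∀ V' : Node h → ℝ, (∀ a, V' a ≤ V₀ a) → energy h η U V ≤ energy h η U V')
    (a : Node h) : V a ≤ 1 := by
  have := sq_one_sub_le_of_energy_le_comp hh (τ := fun t => min t 1)
    (fun s t => by simpa using abs_min_sub_min_le_max s 1 t 1)
    (fun t => by rcases le_total t 1 with ht | ht <;> simp [ht]; rw [abs_of_nonneg] <;> linarith)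
    (fun t => by rcases le_total t 1 with ht | ht <;> simp [ht, sq_nonneg])
    (hmin _ fun a => (min_le_left _ _).trans (hV a)) a
  by_contra! hlt
  rw [min_eq_right hlt.le] at this
  nlinarith

lemma cauchySeq_of_mul_sq_sub_le {x m : ℕ → ℝ} {c l : ℝ} (hc : 0 < c)
    (hm : Tendsto m atTop (nhds l)) (hx : ∀ i j, j ≤ i → c * (x i - x j) ^ 2 ≤ m j - m i) :
    CauchySeq x := by
  rw [Metric.cauchySeq_iff']
  intro ε hε
  obtain ⟨N, hN⟩ := Metric.cauchySeq_iff'.1 hm.cauchySeq (c * ε ^ 2) (by positivity)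
  refine ⟨N, fun n hn => ?_⟩
  have h1 := hN n hn
  rw [Real.dist_eq, abs_lt] at h1
  have h2 : c * (x n - x N) ^ 2 < c * ε ^ 2 := by linarith [hx n N hn]
  exact abs_lt_of_sq_lt_sq (lt_of_mul_lt_mul_left h2 hc.le) hε.le

lemma node_mem_OmegaBd {h : ℕ} (hh : 1 ≤ h) {a : Node h} (ha : a.1 = 0 ∨ a.2 = Fin.last h) :
    node h a ∈ OmegaBd := by
  have hne : (h : ℝ) ≠ 0 := by positivity
  refine ⟨node_mem_OmegaCl hh a, ?_⟩
  rintro ⟨h1, h2⟩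
  rcases ha with ha | ha
  · simp [ha] at h1
  · simp [ha, hne] at h2

/-- A sequence of finite element functions with fixed boundary values converges as soon as the
differences of its nodal values along horizontal edges do. -/
lemma exists_tendsto_nodal {h : ℕ} (hh : 1 ≤ h) {w : E2 → ℝ} {u : ℕ → E2 → ℝ}
    (hbd : ∀ j, ∀ x ∈ OmegaBd, u j x = w x)
    (hd : ∀ k n : Fin h, CauchySeq fun j =>
      nodal h (u j) (k.succ, n.castSucc) - nodal h (u j) (k.castSucc, n.castSucc))
    (a : Node h) : ∃ l, Tendsto (fun j => nodal h (u j) a) atTop (nhds l) := by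
  have hconst {a : Node h} (ha : a.1 = 0 ∨ a.2 = Fin.last h) :
      ∃ l, Tendsto (fun j => nodal h (u j) a) atTop (nhds l) :=
    ⟨w (node h a), by
      simpa only [nodal, hbd _ _ (node_mem_OmegaBd hh ha)] using tendsto_const_nhds⟩
  obtain ⟨k, n⟩ := a
  induction n using Fin.lastCases with
  | last => exact hconst (Or.inr rfl)
  | cast n =>
    induction k using Fin.induction with
    | zero => exact hconst (Or.inl rfl)
    | succ k ih =>
      obtain ⟨l, hl⟩ := ih
      obtain ⟨l', hl'⟩ := cauchySeq_tendsto_of_complete (hd k n)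
      exact ⟨l' + l, by simpa using hl'.add hl⟩

lemma memA_interp_midpoint {h : ℕ} (hh : 1 ≤ h) {w u u' : E2 → ℝ} (hu : MemA h w u)
    (hu' : MemA h w u') :
    MemA h w (interp h fun a => (nodal h u a + nodal h u' a) / 2) := by
  refine ⟨memF_interp hh _, fun x hx => ?_⟩
  have h1 := hu.1.eq_interp hh hx.1
  have h2 := hu'.1.eq_interp hh hx.1
  rw [hu.2 x hx] at h1
  rw [hu'.2 x hx] at h2
  have h3 : interp h (fun a => (nodal h u a + nodal h u' a) / 2) x
      = (interp h (nodal h u) x + interp h (nodal h u') x) / 2 := by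
    simp only [interp, ← Finset.sum_add_distrib, Finset.sum_div]
    exact Finset.sum_congr rfl fun a _ => by ring
  rw [h3, ← h1, ← h2]
  ring

lemma memA_interp_of_tendsto {h : ℕ} (hh : 1 ≤ h) {w : E2 → ℝ} {u : ℕ → E2 → ℝ}
    (hu : ∀ j, MemA h w (u j)) {L : Node h → ℝ}
    (hL : ∀ a, Tendsto (fun j => nodal h (u j) a) atTop (nhds (L a))) :
    MemA h w (interp h L) := by
  refine ⟨memF_interp hh _, fun x hx => ?_⟩
  have h1 : Tendsto (fun j => interp h (nodal h (u j)) x) atTop (nhds (interp h L x)) :=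
    tendsto_finsetSum _ fun a _ => (hL a).mul_const _
  refine tendsto_nhds_unique h1 (tendsto_const_nhds.congr fun j => ?_)
  rw [← (hu j).1.eq_interp hh hx.1, (hu j).2 x hx]

/-- Convergence of the alternating minimization scheme: the sequences
`(u_j)`, `(v_j)` converge in `𝔽_h` to limits `ū, v̄` with `0 ≤ v̄ ≤ 1` on `Ω`, and the pair
`(ū, v̄)` is a critical point: `ū` minimizes `J_h(·, v̄)` over `𝔄_h(w)` and `v̄` minimizes
`J_h(ū, ·)` over `{v ∈ 𝔽_h : v ≤ v̄ on Ω}`. -/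
theorem statement10 (h : ℕ) (hh : 1 ≤ h) (η : ℝ) (hη : 0 < η)
    (v₀ w : E2 → ℝ) (hv₀ : MemF h v₀) (hw : MemF h w)
    (hv₀pos : ∀ x ∈ Omega, 0 ≤ v₀ x)
    (u v : ℕ → E2 → ℝ) (hvz : v 0 = v₀)
    (hu : ∀ j : ℕ, 1 ≤ j → IsMinU h η w (v (j-1)) (u j))
    (hv : ∀ j : ℕ, 1 ≤ j → IsMinV h η (u j) (v (j-1)) (v j)) :
    ∃ ub vb : E2 → ℝ, MemF h ub ∧ MemF h vb ∧
      TendstoF u ub ∧ TendstoF v vb ∧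
      (∀ x ∈ Omega, 0 ≤ vb x ∧ vb x ≤ 1) ∧
      (MemA h w ub ∧ ∀ u', MemA h w u' → Jh h η ub vb ≤ Jh h η u' vb) ∧
      (∀ v', MemF h v' → (∀ x ∈ Omega, v' x ≤ vb x) →
        Jh h η ub vb ≤ Jh h η ub v') := by
  have hVF (j : ℕ) : MemF h (v j) := by
    rcases j with _ | j
    · rwa [hvz]
    · exact (hv (j + 1) (by omega)).1.1
  have hUA (j : ℕ) : MemA h w (u (j + 1)) := (hu (j + 1) (by omega)).1
  have hEU (j : ℕ) (u' : E2 → ℝ) (hu' : MemA h w u') :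
      energy h η (nodal h (u (j + 1))) (nodal h (v j)) ≤ energy h η (nodal h u') (nodal h (v j)) := by
    rw [← Jh_eq_energy hh η (hUA j).1 (hVF j), ← Jh_eq_energy hh η hu'.1 (hVF j)]
    exact (hu (j + 1) (by omega)).2 u' hu'
  have hVle (j : ℕ) (a : Node h) : nodal h (v (j + 1)) a ≤ nodal h (v j) a :=
    (forall_le_iff_nodal_le hh (hVF (j + 1)) (hVF j)).1 (hv (j + 1) (by omega)).1.2 a
  have hEV (j : ℕ) (V' : Node h → ℝ) (hV' : ∀ a, V' a ≤ nodal h (v j) a) :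
      energy h η (nodal h (u (j + 1))) (nodal h (v (j + 1)))
        ≤ energy h η (nodal h (u (j + 1))) V' := by
    have := (hv (j + 1) (by omega)).2 (interp h V') (memF_interp hh V')
      ((forall_le_iff_nodal_le hh (memF_interp hh V') (hVF j)).2
        (by rwa [nodal_interp hh]))
    rwa [Jh_eq_energy hh η (hUA j).1 (hVF _), Jh_eq_energy hh η (hUA j).1 (memF_interp hh V'),
      nodal_interp hh] at this
  have hV0 (j : ℕ) : ∀ a, 0 ≤ nodal h (v j) a := by
    induction j with
    | zero =>
      rw [hvz]
      exact (forall_le_iff_nodal_le hh (memF_const h 0) hv₀).1 hv₀pos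
    | succ j ih => exact nonneg_of_energy_le hh ih (hVle j) (hEV j)
  have hV1 (j : ℕ) : ∀ a, nodal h (v (j + 1)) a ≤ 1 := le_one_of_energy_le hh (hVle j) (hEV j)
  have hanti (a : Node h) : Antitone fun j => nodal h (v j) a :=
    antitone_nat_of_succ_le fun j => hVle j a
  have hVlim (a : Node h) : ∃ l, Tendsto (fun j => nodal h (v j) a) atTop (nhds l) :=
    ⟨_, tendsto_atTop_ciInf (hanti a) ⟨0, by rintro _ ⟨j, rfl⟩; exact hV0 j a⟩⟩
  choose Vb hVb using hVlim
  set m : ℕ → ℝ := fun j => elastic h η (nodal h (u (j + 1))) (nodal h (v j)) with hm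
  have hQ (j : ℕ) (u' : E2 → ℝ) (hu' : MemA h w u') :
      m j ≤ elastic h η (nodal h u') (nodal h (v j)) := by
    have := hEU j u' hu'
    unfold energy at this
    simp only [hm]
    linarith
  have hmono (i j : ℕ) (hij : j ≤ i) : elastic h η (nodal h (u (j + 1))) (nodal h (v i)) ≤ m j :=
    elastic_mono η _ (hV0 i) fun a => hanti a hij
  have hmanti : Antitone m := fun j i hij => (hQ i _ (hUA j)).trans (hmono i j hij)
  have hmlim : Tendsto m atTop (nhds (⨅ j, m j)) :=
    tendsto_atTop_ciInf hmanti ⟨0, by rintro _ ⟨j, rfl⟩; exact elastic_nonneg hη _ _⟩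
  have hcontr (i j : ℕ) (hij : j ≤ i) :
      η / 2 * weightedEnergy h (fun _ => 1)
        (fun a => nodal h (u (i + 1)) a - nodal h (u (j + 1)) a) ≤ m j - m i := by
    have h1 := elastic_parallelogram hh (η := η) (nodal h (u (i + 1))) (nodal h (u (j + 1)))
      (nodal h (v i))
    have h2 := hQ i _ (memA_interp_midpoint hh (hUA i) (hUA j))
    rw [nodal_interp hh] at h2
    have h3 := hmono i j hij
    have h4 : η * weightedEnergy h (fun _ => 1)
        (fun a => nodal h (u (i + 1)) a - nodal h (u (j + 1)) a) ≤
        elastic h η (fun a => nodal h (u (i + 1)) a - nodal h (u (j + 1)) a) (nodal h (v i)) :=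
      le_add_of_nonneg_left (Finset.sum_nonneg fun e _ =>
        mul_nonneg (sq_nonneg _) (weightedEnergy_nonneg (hat_nonneg h e) _))
    have h5 : elastic h η (nodal h (u (i + 1))) (nodal h (v i)) = m i := rfl
    linarith
  have hUlim := exists_tendsto_nodal hh (u := fun j => u (j + 1)) (fun j => (hUA j).2)
    fun k n => by
      obtain ⟨c, hc, hcU⟩ := exists_sq_sub_le_weightedEnergy_one hh k n
      refine cauchySeq_of_mul_sq_sub_le (c := η / 2 * c) (by positivity) hmlim fun i j hij => ?_
      refine le_trans ?_ (hcontr i j hij)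
      rw [mul_assoc]
      refine mul_le_mul_of_nonneg_left (le_trans (le_of_eq ?_) (hcU _)) (by positivity)
      ring
  choose Ub hUb using hUlim
  have hlimU : Tendsto (fun j => nodal h (u (j + 1))) atTop (nhds Ub) := tendsto_pi_nhds.2 hUb
  have hlimV : Tendsto (fun j => nodal h (v j)) atTop (nhds Vb) := tendsto_pi_nhds.2 hVb
  have hlimV' := hlimV.comp (tendsto_add_atTop_nat 1)
  have hcont := continuous_energy hh η
  have hVb0 (a : Node h) : 0 ≤ Vb a := ge_of_tendsto' (hVb a) fun j => hV0 j a
  have hVb1 (a : Node h) : Vb a ≤ 1 :=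
    le_of_tendsto' ((hVb a).comp (tendsto_add_atTop_nat 1)) fun j => hV1 j a
  have hUbF := memF_interp hh Ub
  have hVbF := memF_interp hh Vb
  refine ⟨interp h Ub, interp h Vb, hUbF, hVbF, ?_, ?_, ?_, ⟨?_, ?_⟩, ?_⟩
  · refine tendstoF_of_tendsto_nodal hh ?_ hUbF ?_
    · filter_upwards [eventually_ge_atTop 1] with j hj
      exact (hu j hj).1.1
    · rw [nodal_interp hh]
      exact fun a => (tendsto_add_atTop_iff_nat 1).1 (hUb a)
  · refine tendstoF_of_tendsto_nodal hh (Eventually.of_forall hVF) hVbF ?_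
    rwa [nodal_interp hh]
  · intro x hx
    constructor
    · refine (forall_le_iff_nodal_le hh (memF_const h 0) hVbF).2 ?_ x hx
      rwa [nodal_interp hh]
    · refine (forall_le_iff_nodal_le hh hVbF (memF_const h 1)).2 ?_ x hx
      rwa [nodal_interp hh]
  · exact memA_interp_of_tendsto hh hUA hUb
  · intro u' hu'
    rw [Jh_eq_energy hh η hUbF hVbF, Jh_eq_energy hh η hu'.1 hVbF, nodal_interp hh,
      nodal_interp hh]
    exact le_of_tendsto_of_tendsto' ((hcont.tendsto (Ub, Vb)).comp (hlimU.prodMk_nhds hlimV))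
      ((hcont.tendsto (nodal h u', Vb)).comp (tendsto_const_nhds.prodMk_nhds hlimV))
      fun j => hEU j u' hu'
  · intro v' hv' hle
    rw [Jh_eq_energy hh η hUbF hVbF, Jh_eq_energy hh η hUbF hv', nodal_interp hh,
      nodal_interp hh]
    have hle' := (forall_le_iff_nodal_le hh hv' hVbF).1 hle
    rw [nodal_interp hh] at hle'
    exact le_of_tendsto_of_tendsto' ((hcont.tendsto (Ub, Vb)).comp (hlimU.prodMk_nhds hlimV'))
      ((hcont.tendsto (Ub, nodal h v')).comp (hlimU.prodMk_nhds tendsto_const_nhds))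
      fun j => hEV j _ fun a => (hle' a).trans ((hanti a).le_of_tendsto (hVb a) j)
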